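/- arXiv:1908.09654 — 3 statements merged into one kernel-verified Lean document; each statement's English description precedes it below -/
import Mathlib

section
/- Let γ : G → Aut(A) be a map from a discrete group G to the *-automorphisms of a unital C*-algebra A, and suppose that u, u' : G × G → U(A) are two maps such that both (γ, u) and (γ, u') are twisted actions of G on A (with the same automorphism part γ). Define ω(g, h) = u(g, h) u'(g, h)*. Then for all g, h, k ∈ G: ω(g, h) lies in the center Z(A) of A, ω(g, e) = ω(e, g) = 1_A, and γ_g(ω(h, k)) ω(g, hk) = ω(g, h) ω(gh, k); that is, ω is a normalized 2-cocycle for the restriction of γ to Z(A). -/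
/-- `(α, σ)` is a twisted action of `G` on `A`: each `α g` is a *-automorphism of `A`,
`σ` takes values in the unitary group of `A`, and the twisted-action identities hold. -/
structure IsTwistedAction {G : Type*} [Group G] {A : Type*} [NormedRing A] [StarRing A]
    [CStarRing A] [NormedAlgebra ℂ A] [StarModule ℂ A] [CompleteSpace A]
    (α : G → A → A) (σ : G → G → A) : Prop where
  autom : ∀ g, ∃ f : A ≃⋆ₐ[ℂ] A, α g = f
  unitary' : ∀ g h, σ g h ∈ unitary A
  ad : ∀ g h a, α g (α h a) = σ g h * α (g * h) a * star (σ g h)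
  coc : ∀ g h k, α g (σ h k) * σ g (h * k) = σ g h * σ (g * h) k
  one_right : ∀ g, σ g 1 = 1
  one_left : ∀ g, σ 1 g = 1

/-- The perturbed action `α^w`, given by `α^w_g = Ad(w(g)) ∘ α_g`. -/
def pertAct {G A : Type*} [Group G] [Ring A] [StarRing A]
    (α : G → A → A) (w : G → A) : G → A → A :=
  fun g a => w g * α g a * star (w g)

/-- The perturbed 2-cocycle `σ^w(g, g') = w(g) α_g(w(g')) σ(g, g') w(gg')*`. -/
def pertCoc {G A : Type*} [Group G] [Ring A] [StarRing A]
    (α : G → A → A) (σ : G → G → A) (w : G → A) : G → G → A :=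
  fun g g' => w g * α g (w g') * σ g g' * star (w (g * g'))

/-- Two cocycles that twist the same automorphisms differ by central elements. -/
theorem IsTwistedAction.mul_star_mem_center {G : Type*} [Group G] {A : Type*}
    [NormedRing A] [StarRing A] [CStarRing A] [NormedAlgebra ℂ A] [StarModule ℂ A]
    [CompleteSpace A] {γ : G → A → A} {u u' : G → G → A}
    (hu : IsTwistedAction γ u) (hu' : IsTwistedAction γ u') (g h : G) :
    u g h * star (u' g h) ∈ Set.center A := by
  rw [Semigroup.mem_center_iff]
  intro b
  obtain ⟨a, rfl⟩ : ∃ a, γ g (γ h a) = b := by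
    obtain ⟨f, hf⟩ := hu.autom g
    obtain ⟨f', hf'⟩ := hu.autom h
    exact ⟨f'.symm (f.symm b), by simp [hf, hf']⟩
  have h₁ : star (u g h) * u g h = 1 := Unitary.star_mul_self_of_mem (hu.unitary' g h)
  have h₂ : star (u' g h) * u' g h = 1 := Unitary.star_mul_self_of_mem (hu'.unitary' g h)
  calc γ g (γ h a) * (u g h * star (u' g h))
      = u g h * γ (g * h) a * (star (u g h) * u g h) * star (u' g h) := by
        rw [hu.ad]; noncomm_ring
    _ = u g h * (star (u' g h) * u' g h) * γ (g * h) a * star (u' g h) := by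
        rw [h₁, h₂]; noncomm_ring
    _ = u g h * star (u' g h) * γ g (γ h a) := by
        rw [hu'.ad]; noncomm_ring

/-- if `(γ, u)` and `(γ, u')` are twisted actions with the same automorphism
part `γ`, then `ω(g, h) = u(g, h) u'(g, h)*` is a normalized central 2-cocycle for
(the restriction to the center of) `γ`. -/
theorem two_cocycles_same_action_quotient {G : Type*} [Group G] {A : Type*}
    [NormedRing A] [StarRing A] [CStarRing A] [NormedAlgebra ℂ A] [StarModule ℂ A]
    [CompleteSpace A]
    (γ : G → A → A) (u u' : G → G → A)
    (hts : IsTwistedAction γ u) (hts' : IsTwistedAction γ u') :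
    (∀ g h, u g h * star (u' g h) ∈ Set.center A) ∧
    (∀ g, u g 1 * star (u' g 1) = (1 : A)) ∧
    (∀ g, u 1 g * star (u' 1 g) = (1 : A)) ∧
    (∀ g h k, γ g (u h k * star (u' h k)) * (u g (h * k) * star (u' g (h * k))) =
      (u g h * star (u' g h)) * (u (g * h) k * star (u' (g * h) k))) := by
  have center := hts.mul_star_mem_center hts'
  refine ⟨center, fun g => by simp [hts.one_right, hts'.one_right],
    fun g => by simp [hts.one_left, hts'.one_left], fun g h k => ?_⟩
  have factor : ∀ x y, u x y * star (u' x y) * u' x y = u x y := fun x y => by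
    rw [mul_assoc, Unitary.star_mul_self_of_mem (hts'.unitary' x y), mul_one]
  have map_mul : ∀ a b, γ g (a * b) = γ g a * γ g b := by
    obtain ⟨f, hf⟩ := hts.autom g
    simp [hf]
  have unit : IsUnit (u' g h * u' (g * h) k) :=
    (Unitary.isUnit_coe (U := ⟨_, hts'.unitary' g h⟩)).mul
      (Unitary.isUnit_coe (U := ⟨_, hts'.unitary' (g * h) k⟩))
  have comm : ∀ x y b, b * (u x y * star (u' x y)) = u x y * star (u' x y) * b :=
    fun x y => Semigroup.mem_center_iff.mp (center x y)
  have coc := hts.coc g h k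
  rw [← factor h k, ← factor g (h * k), ← factor g h, ← factor (g * h) k, map_mul] at coc
  generalize hω : (fun x y => u x y * star (u' x y)) = ω at *
  simp only [funext_iff] at hω
  simp only [hω] at *
  apply unit.mul_right_cancel
  calc γ g (ω h k) * ω g (h * k) * (u' g h * u' (g * h) k)
      = γ g (ω h k) * (ω g (h * k) * γ g (u' h k)) * u' g (h * k) := by
        rw [← hts'.coc]; noncomm_ring
    _ = γ g (ω h k) * γ g (u' h k) * (ω g (h * k) * u' g (h * k)) := by
        rw [← comm]; noncomm_ring
    _ = ω g h * (u' g h * ω (g * h) k) * u' (g * h) k := by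
        rw [coc]; noncomm_ring
    _ = ω g h * ω (g * h) k * (u' g h * u' (g * h) k) := by
        rw [comm]; noncomm_ring
end

section
/- Let Σ = (A, G, α, σ) be a twisted C*-dynamical system, let (ρ, v) be an equivariant representation of Σ on an inner-product A-module X, and let w : G → U(A) be a normalized map. Define ṽ(g) : X → X by ṽ(g)x = (ρ(w(g))(v(g)x))·w(g)*. Then each ṽ(g) is an invertible ℂ-linear map and (ρ, ṽ) is an equivariant representation of the perturbed system Σ^w = (A, G, α^w, σ^w) on X; that is, for all g, h ∈ G, a ∈ A and x, x' ∈ X: (i) ρ(α^w_g(a)) ṽ(g) = ṽ(g) ρ(a); (ii) ṽ(g)(ṽ(h)x) = (ρ(σ^w(g,h))(ṽ(gh)x))·σ^w(g,h)*; (iii) α^w_g(⟨x, x'⟩) = ⟨ṽ(g)x, ṽ(g)x'⟩; (iv) ṽ(g)(x·a) = (ṽ(g)x)·α^w_g(a). -/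
/-- An inner-product `A`-module: a complex vector space `X` with a right `A`-action and an
`A`-valued inner product. -/
structure IPMod (A : Type*) (X : Type*) [NormedRing A] [StarRing A] [NormedAlgebra ℂ A]
    [AddCommGroup X] [Module ℂ X] where
  rsmul : X → A → X
  inner : X → X → A
  rsmul_add : ∀ x a b, rsmul x (a + b) = rsmul x a + rsmul x b
  add_rsmul : ∀ x y a, rsmul (x + y) a = rsmul x a + rsmul y a
  rsmul_mul : ∀ x a b, rsmul x (a * b) = rsmul (rsmul x a) b
  rsmul_one : ∀ x, rsmul x 1 = x
  rsmul_csmul : ∀ x (c : ℂ) a, rsmul x (c • a) = c • rsmul x a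
  inner_add_left : ∀ x y z, inner (x + y) z = inner x z + inner y z
  inner_add_right : ∀ x y z, inner x (y + z) = inner x y + inner x z
  inner_rsmul_right : ∀ x y a, inner x (rsmul y a) = inner x y * a
  inner_star : ∀ x y, star (inner x y) = inner y x

/-- `(ρ, v)` is an equivariant representation of the twisted system `(A, G, α, σ)` on the
inner-product `A`-module `(X, M)`. -/
structure IsEqvRep {G : Type*} [Group G] {A : Type*} [NormedRing A] [StarRing A]
    [CStarRing A] [NormedAlgebra ℂ A] [StarModule ℂ A] [CompleteSpace A]
    {X : Type*} [AddCommGroup X] [Module ℂ X]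
    (α : G → A → A) (σ : G → G → A) (M : IPMod A X)
    (ρ : A → X → X) (v : G → X → X) : Prop where
  ρ_linear : ∀ a, IsLinearMap ℂ (ρ a)
  ρ_rsmul : ∀ a x b, ρ a (M.rsmul x b) = M.rsmul (ρ a x) b
  ρ_add : ∀ a b x, ρ (a + b) x = ρ a x + ρ b x
  ρ_smul : ∀ (c : ℂ) a x, ρ (c • a) x = c • ρ a x
  ρ_one : ∀ x, ρ 1 x = x
  ρ_mul : ∀ a b x, ρ (a * b) x = ρ a (ρ b x)
  ρ_adjoint : ∀ a x y, M.inner (ρ a x) y = M.inner x (ρ (star a) y)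
  v_linear : ∀ g, IsLinearMap ℂ (v g)
  v_bijective : ∀ g, Function.Bijective (v g)
  intertwine : ∀ g a x, ρ (α g a) (v g x) = v g (ρ a x)
  v_mul : ∀ g h x, v g (v h x) = M.rsmul (ρ (σ g h) (v (g * h) x)) (star (σ g h))
  inner_eq : ∀ g x x', α g (M.inner x x') = M.inner (v g x) (v g x')
  v_rsmul : ∀ g x a, v g (M.rsmul x a) = M.rsmul (v g x) (α g a)

namespace IPMod

variable {A X : Type*} [NormedRing A] [StarRing A] [NormedAlgebra ℂ A]
  [AddCommGroup X] [Module ℂ X] (M : IPMod A X)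

theorem smul_rsmul (c : ℂ) (x : X) (a : A) : M.rsmul (c • x) a = c • M.rsmul x a := by
  have h : M.rsmul x (c • 1) = c • x := by rw [M.rsmul_csmul, M.rsmul_one]
  rw [← h, ← M.rsmul_mul, smul_mul_assoc, one_mul, M.rsmul_csmul]

theorem inner_rsmul_left (x y : X) (a : A) :
    M.inner (M.rsmul x a) y = star a * M.inner x y := by
  rw [← M.inner_star, M.inner_rsmul_right, star_mul, M.inner_star]

end IPMod

namespace IsEqvRep

variable {G : Type*} [Group G] {A : Type*} [NormedRing A] [StarRing A] [CStarRing A]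
  [NormedAlgebra ℂ A] [StarModule ℂ A] [CompleteSpace A] {X : Type*} [AddCommGroup X]
  [Module ℂ X] {α : G → A → A} {σ : G → G → A} {M : IPMod A X} {ρ : A → X → X} {v : G → X → X}

/-- Conjugation by `u` and then by `b` with `b * u = 1` is the identity. -/
theorem conj_conj (hE : IsEqvRep α σ M ρ v) {u b : A} (h : b * u = 1) (x : X) :
    M.rsmul (ρ b (M.rsmul (ρ u x) (star u))) (star b) = x := by
  rw [hE.ρ_rsmul, ← hE.ρ_mul, ← M.rsmul_mul, ← star_mul, h, star_one, hE.ρ_one, M.rsmul_one]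

theorem conj_bijective (hE : IsEqvRep α σ M ρ v) {u : A} (hu : u ∈ unitary A) :
    Function.Bijective fun x => M.rsmul (ρ u x) (star u) :=
  Function.bijective_iff_has_inverse.2 ⟨fun x => M.rsmul (ρ (star u) x) (star (star u)),
    hE.conj_conj (Unitary.star_mul_self_of_mem hu), hE.conj_conj (Unitary.mul_star_self_of_mem hu)⟩

theorem conj_isLinearMap (hE : IsEqvRep α σ M ρ v) (g : G) (u : A) :
    IsLinearMap ℂ fun x => M.rsmul (ρ u (v g x)) (star u) where
  map_add x y := by rw [(hE.v_linear g).map_add, (hE.ρ_linear u).map_add, M.add_rsmul]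
  map_smul c x := by rw [(hE.v_linear g).map_smul, (hE.ρ_linear u).map_smul, M.smul_rsmul]

end IsEqvRep

/-- if `(ρ, v)` is an equivariant representation of `Σ` on `X` and `w` is a
normalized unitary-valued map, then `ṽ(g)x = (ρ(w(g))(v(g)x))·w(g)*` gives invertible
`ℂ`-linear maps and `(ρ, ṽ)` is an equivariant representation of the perturbed system
`Σ^w` on `X`. -/
theorem perturbed_equivariant_representation {G : Type*} [Group G] {A : Type*}
    [NormedRing A] [StarRing A] [CStarRing A] [NormedAlgebra ℂ A] [StarModule ℂ A]
    [CompleteSpace A] {X : Type*} [AddCommGroup X] [Module ℂ X]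
    (α : G → A → A) (σ : G → G → A) (M : IPMod A X)
    (ρ : A → X → X) (v : G → X → X)
    (hts : IsTwistedAction α σ)
    (hE : IsEqvRep α σ M ρ v)
    (w : G → A) (hw : ∀ g, w g ∈ unitary A) (hw1 : w 1 = 1) :
    (∀ g, IsLinearMap ℂ (fun x => M.rsmul (ρ (w g) (v g x)) (star (w g))) ∧
      Function.Bijective (fun x => M.rsmul (ρ (w g) (v g x)) (star (w g)))) ∧
    IsEqvRep (pertAct α w) (pertCoc α σ w) M ρ
      (fun g x => M.rsmul (ρ (w g) (v g x)) (star (w g))) := by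
  have hs g : star (w g) * w g = 1 := Unitary.star_mul_self_of_mem (hw g)
  have hlin g := hE.conj_isLinearMap g (w g)
  have hbij g : Function.Bijective fun x => M.rsmul (ρ (w g) (v g x)) (star (w g)) :=
    (hE.conj_bijective (hw g)).comp (hE.v_bijective g)
  have hstar g a : α g (star a) = star (α g a) := by
    obtain ⟨f, hf⟩ := hts.autom g
    rw [hf, map_star]
  refine ⟨fun g => ⟨hlin g, hbij g⟩, ?_⟩
  exact
  { ρ_linear := hE.ρ_linear
    ρ_rsmul := hE.ρ_rsmul
    ρ_add := hE.ρ_add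
    ρ_smul := hE.ρ_smul
    ρ_one := hE.ρ_one
    ρ_mul := hE.ρ_mul
    ρ_adjoint := hE.ρ_adjoint
    v_linear := hlin
    v_bijective := hbij
    intertwine := fun g a x => by
      simp only [pertAct]
      rw [hE.ρ_rsmul, ← hE.ρ_mul, mul_assoc, hs, mul_one, hE.ρ_mul, hE.intertwine]
    v_mul := fun g h x => by
      simp only [pertCoc]
      rw [hE.v_rsmul, ← hE.intertwine, hE.v_mul]
      simp only [hE.ρ_rsmul, ← hE.ρ_mul, ← M.rsmul_mul]
      simp only [star_mul, star_star, hstar, mul_assoc, hs, mul_one]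
      rw [← mul_assoc (star (w (g * h))), hs, one_mul]
    inner_eq := fun g x x' => by
      simp only [pertAct]
      rw [M.inner_rsmul_right, M.inner_rsmul_left, star_star, hE.ρ_adjoint, ← hE.ρ_mul, hs,
        hE.ρ_one, hE.inner_eq]
    v_rsmul := fun g x a => by
      simp only [pertAct]
      rw [hE.v_rsmul, hE.ρ_rsmul, ← M.rsmul_mul, ← M.rsmul_mul, mul_assoc (w g),
        ← mul_assoc (star (w g)), hs, one_mul] }
end

section
/- Let α be a group homomorphism from a discrete group G into Aut(A), where A is a unital C*-algebra. Let ι be an index type with a filter l, and for each ν ∈ ι let ξ_ν : G → A be a finitely supported function taking its values in the center Z(A) of A. Then the following are equivalent: (1) for every g ∈ G and every a ∈ A, the net ‖ Σ_{h ∈ G} ξ_ν(h)* a α_g(ξ_ν(g⁻¹h)) − a ‖ converges to 0 along l (the sum being the finite sum over the relevant supports); (2) for every g ∈ G, the net ‖ Σ_{h ∈ G} ξ_ν(h)* α_g(ξ_ν(g⁻¹h)) − 1_A ‖ converges to 0 along l. -/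
/-- A twisted sum with central left coefficients factors through left multiplication. -/
theorem finsum_star_mul_mul_eq_mul_finsum {G A : Type*} [Ring A] [StarRing A]
    (ξ η : G → A) (hfin : (Function.support ξ).Finite) (hcen : ∀ g, ξ g ∈ Set.center A) (a : A) :
    ∑ᶠ h, star (ξ h) * a * η h = a * ∑ᶠ h, star (ξ h) * η h := by
  have hsupp : (Function.support fun h => star (ξ h) * η h).Finite :=
    hfin.subset fun h hh hξ => hh (by simp [hξ])
  rw [mul_finsum' _ _ hsupp]
  refine finsum_congr fun h => ?_
  rw [(Set.star_mem_center (hcen h)).comm a, mul_assoc]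

/-- for a genuine action `α` of `G` on `A` and a net `ξ_ν` of finitely
supported central-valued functions `G → A`, the approximation condition
`‖Σ_h ξ_ν(h)* a α_g(ξ_ν(g⁻¹h)) − a‖ → 0` for all `g, a` is equivalent to the condition
`‖Σ_h ξ_ν(h)* α_g(ξ_ν(g⁻¹h)) − 1‖ → 0` for all `g`. -/
theorem central_approximation_property_iff {G : Type*} [Group G] {A : Type*}
    [NormedRing A] [StarRing A] [CStarRing A] [NormedAlgebra ℂ A] [StarModule ℂ A]
    [CompleteSpace A] {ι : Type*} (l : Filter ι)
    (α : G → A → A)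
    (hα_aut : ∀ g, ∃ f : A ≃⋆ₐ[ℂ] A, α g = f)
    (hα_one : ∀ a, α 1 a = a)
    (hα_mul : ∀ g h a, α (g * h) a = α g (α h a))
    (ξ : ι → G → A)
    (hfin : ∀ ν, (Function.support (ξ ν)).Finite)
    (hcen : ∀ ν g, ξ ν g ∈ Set.center A) :
    (∀ (g : G) (a : A),
      Filter.Tendsto
        (fun ν => ‖(∑ᶠ h : G, star (ξ ν h) * a * α g (ξ ν (g⁻¹ * h))) - a‖) l (nhds 0)) ↔
    (∀ g : G,
      Filter.Tendsto
        (fun ν => ‖(∑ᶠ h : G, star (ξ ν h) * α g (ξ ν (g⁻¹ * h))) - 1‖) l (nhds 0)) := by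
  refine ⟨fun H g => by simpa using H g 1, fun H g a => ?_⟩
  have hlim := (H g).const_mul ‖a‖
  rw [mul_zero] at hlim
  refine squeeze_zero (fun _ => norm_nonneg _) (fun ν => ?_) hlim
  rw [finsum_star_mul_mul_eq_mul_finsum (ξ ν) (fun h => α g (ξ ν (g⁻¹ * h))) (hfin ν) (hcen ν) a]
  simpa [mul_sub] using
    norm_mul_le a ((∑ᶠ h : G, star (ξ ν h) * α g (ξ ν (g⁻¹ * h))) - 1)
end
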